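/- arXiv:math/0608232 — 6 statements merged into one kernel-verified Lean document; each statement's English description precedes it below -/
import Mathlib

section
/- For all integers k ≥ 1 and all integers p with 0 ≤ p ≤ k, the identity F_p^k = F̄_p^k − q_k·(1 − x_k)·F̄_{p−1}^{k−1} holds in ℤ[q_1, q_2, …, x_1, x_2, …]. -/
open MvPolynomial Finset

noncomputable section

/-- The polynomial ring `ℤ[q_1, q_2, …, x_1, x_2, …]`; the variable `Sum.inl i` is `q_i`
and `Sum.inr i` is `x_i`. -/
abbrev P : Type := MvPolynomial (ℕ ⊕ ℕ) ℤ

/-- The variable `q_i`. -/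
def qv (i : ℕ) : P := X (Sum.inl i)

/-- The variable `x_i`. -/
def xv (i : ℕ) : P := X (Sum.inr i)

/-- The polynomial `F_p^k`, defined as `0` unless `0 ≤ p ≤ k`. -/
def Fp (p k : ℤ) : P :=
  if 0 ≤ p ∧ p ≤ k then
    ∑ I ∈ (Finset.Icc 1 k.toNat).powersetCard p.toNat,
      (∏ i ∈ I, (1 - xv i)) * ∏ i ∈ I.filter (fun i => i + 1 ∉ I), (1 - qv i)
  else 0

/-- The substitution `q_k ↦ 0`. -/
def setQ (k : ℕ) : P →ₐ[ℤ] P :=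
  aeval (fun v => if v = Sum.inl k then 0 else X v)

/-- `F̄_p^k`, i.e. `F_p^k` with `q_k` set to `0`. -/
def Fbar (p k : ℤ) : P := setQ k.toNat (Fp p k)

theorem setQ_qv (k i : ℕ) : setQ k (qv i) = if i = k then 0 else qv i := by
  simp [setQ, qv]

theorem setQ_xv (k i : ℕ) : setQ k (xv i) = xv i := by
  simp [setQ, xv]

theorem setQ_comm (k l : ℕ) (f : P) : setQ k (setQ l f) = setQ l (setQ k f) := by
  have h : (setQ k).comp (setQ l) = (setQ l).comp (setQ k) := by
    apply MvPolynomial.algHom_ext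
    rintro (i | i)
    · change setQ k (setQ l (qv i)) = setQ l (setQ k (qv i))
      rw [setQ_qv, setQ_qv]
      split_ifs <;> simp_all [setQ_qv]
    · change setQ k (setQ l (xv i)) = setQ l (setQ k (xv i))
      simp only [setQ_xv]
  exact DFunLike.congr_fun h f

/-- The summand of `F_p^k` indexed by the set `I`. -/
def weight (I : Finset ℕ) : P :=
  (∏ i ∈ I, (1 - xv i)) * ∏ i ∈ I.filter (fun i => i + 1 ∉ I), (1 - qv i)

theorem setQ_weight (k : ℕ) (I : Finset ℕ) :
    setQ k (weight I) = (∏ i ∈ I, (1 - xv i)) *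
      ∏ i ∈ I.filter (fun i => i + 1 ∉ I), (1 - if i = k then 0 else qv i) := by
  simp only [weight, map_mul, map_prod, map_sub, map_one, setQ_qv, setQ_xv]

theorem setQ_weight_of_notMem {k : ℕ} {I : Finset ℕ} (hk : k ∉ I) :
    setQ k (weight I) = weight I := by
  rw [setQ_weight, weight]
  congr 1
  refine prod_congr rfl fun i hi => ?_
  rw [if_neg]
  rintro rfl
  exact hk (mem_filter.1 hi).1

theorem weight_insert {n : ℕ} {J : Finset ℕ} (hJ : ∀ i ∈ J, i ≤ n) :
    weight (insert (n + 1) J) =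
      (1 - xv (n + 1)) * (1 - qv (n + 1)) * setQ n (weight J) := by
  have h1 : n + 1 ∉ J := fun h => by have := hJ _ h; omega
  have h2 : n + 1 + 1 ∉ J := fun h => by have := hJ _ h; omega
  rw [setQ_weight, weight, prod_insert h1, prod_filter, prod_insert h1, prod_filter]
  have h3 : ∀ i ∈ J, (if i + 1 ∉ insert (n + 1) J then 1 - qv i else 1) =
      if i + 1 ∉ J then 1 - (if i = n then 0 else qv i) else 1 := by
    intro i _
    by_cases hin : i = n <;> simp [hin]
  rw [prod_congr rfl h3, if_pos (by simp [h2])]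
  ring

theorem weight_insert_eq_sub {n : ℕ} {J : Finset ℕ} (hJ : ∀ i ∈ J, i ≤ n) :
    weight (insert (n + 1) J) = setQ (n + 1) (weight (insert (n + 1) J)) -
      qv (n + 1) * (1 - xv (n + 1)) * setQ n (weight J) := by
  have h1 : n + 1 ∉ J := fun h => by have := hJ _ h; omega
  rw [weight_insert hJ]
  simp only [map_mul, map_sub, map_one, setQ_qv, setQ_xv, if_true]
  rw [setQ_comm, setQ_weight_of_notMem h1]
  ring

theorem Fp_natCast {p k : ℕ} (h : p ≤ k) :
    Fp p k = ∑ I ∈ (Icc 1 k).powersetCard p, weight I := by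
  simp [Fp, weight, h]

theorem sum_powersetCard_Icc_succ (p n : ℕ) (f : Finset ℕ → P) :
    ∑ I ∈ (Icc 1 (n + 1)).powersetCard (p + 1), f I =
      ∑ I ∈ (Icc 1 n).powersetCard (p + 1), f I +
        ∑ J ∈ (Icc 1 n).powersetCard p, f (insert (n + 1) J) := by
  have hn : n + 1 ∉ Icc 1 n := by simp
  have hmem : ∀ {m : ℕ} {J}, J ∈ (Icc 1 n).powersetCard m → n + 1 ∉ J :=
    fun hJ h => hn ((mem_powersetCard.1 hJ).1 h)
  rw [← insert_Icc_right_eq_Icc_add_one (by omega), powersetCard_succ_insert hn, sum_union,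
    sum_image]
  · intro A hA B hB hAB
    rw [← erase_insert (hmem hA), ← erase_insert (hmem hB)]
    exact congrArg (fun s => s.erase (n + 1)) hAB
  · rw [disjoint_left]
    intro I hI hI'
    obtain ⟨J, -, rfl⟩ := mem_image.1 hI'
    exact hmem hI (mem_insert_self _ _)

/-- For all integers `k ≥ 1` and `0 ≤ p ≤ k`,
`F_p^k = F̄_p^k − q_k·(1 − x_k)·F̄_{p−1}^{k−1}`. -/
theorem statement0 (k p : ℤ) (hk : 1 ≤ k) (hp : 0 ≤ p) (hpk : p ≤ k) :
    Fp p k = Fbar p k - qv k.toNat * (1 - xv k.toNat) * Fbar (p - 1) (k - 1) := by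
  obtain ⟨n, rfl⟩ : ∃ n : ℕ, k = (n + 1 : ℕ) := ⟨(k - 1).toNat, by omega⟩
  lift p to ℕ using hp
  have hk' : ((n + 1 : ℕ) : ℤ) - 1 = n := by push_cast; ring
  rw [hk']
  simp only [Fbar, Int.toNat_natCast]
  have hle : p ≤ n + 1 := by exact_mod_cast hpk
  rw [Fp_natCast hle]
  cases p with
  | zero =>
    simp [Fp, weight]
  | succ p =>
    have hp' : ((p + 1 : ℕ) : ℤ) - 1 = p := by push_cast; ring
    rw [hp', Fp_natCast (Nat.le_of_succ_le_succ hle), sum_powersetCard_Icc_succ, map_add,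
      map_sum, map_sum, map_sum, mul_sum, add_sub_assoc, ← sum_sub_distrib]
    congr 1
    · refine sum_congr rfl fun I hI => (setQ_weight_of_notMem fun h => ?_).symm
      simpa using (mem_powersetCard.1 hI).1 h
    · refine sum_congr rfl fun J hJ => weight_insert_eq_sub fun i hi => ?_
      exact (mem_Icc.1 ((mem_powersetCard.1 hJ).1 hi)).2
end
end

section
/- For all integers p, k with 1 ≤ p ≤ k, the identity Σ_{i=p}^k (−1)^{i−p} C(i−1, p−1) Ê_i^k = 1 + Σ_{i=k−p+1}^k (−1)^{i−k+p} C(i−1, k−p) F_i^k holds in ℤ[q_1, q_2, …, x_1, x_2, …]. -/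
open MvPolynomial Finset

noncomputable section

/-- The polynomial `Ê_p^k = Σ_{i=0}^p (−1)^i C(k−i, p−i) F_i^k`, defined as `0` unless
`0 ≤ p ≤ k`. -/
def Ehat (p k : ℤ) : P :=
  if 0 ≤ p ∧ p ≤ k then
    ∑ i ∈ Finset.range (p.toNat + 1),
      (-1 : P) ^ i * (Nat.choose (k.toNat - i) (p.toNat - i) : P) * Fp (i : ℤ) k
  else 0

/-- `Ē_p^k`, i.e. `Ê_p^k` with `q_k` set to `0`. -/
def Ebar (p k : ℤ) : P := setQ k.toNat (Ehat p k)

/-- The alternating binomial transform of `m ↦ C(m + a, s)`, i.e. its iterated difference. -/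
theorem sum_neg_one_pow_choose_mul_choose_add (n a s t : ℕ) (h : s + t = n + a) :
    ∑ m ∈ range (n + 1), (-1 : ℤ) ^ m * n.choose m * (m + a).choose s =
      (-1) ^ n * a.choose t := by
  induction n generalizing a t with
  | zero =>
    have : a.choose s = a.choose t := Nat.choose_symm_of_eq_add (by lia)
    simp [this]
  | succ n ih =>
    have split : ∑ m ∈ range (n + 1 + 1), (-1 : ℤ) ^ m * (n + 1).choose m * (m + a).choose s =
        ∑ m ∈ range (n + 1), (-1 : ℤ) ^ m * n.choose m * (m + a).choose s -
          ∑ m ∈ range (n + 1), (-1 : ℤ) ^ m * n.choose m * (m + (a + 1)).choose s := by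
      have extend : ∑ m ∈ range (n + 1), (-1 : ℤ) ^ m * n.choose m * (m + a).choose s =
          ∑ m ∈ range (n + 1 + 1), (-1 : ℤ) ^ m * n.choose m * (m + a).choose s := by
        rw [sum_range_succ _ (n + 1)]
        simp
      rw [extend, sum_range_succ', sum_range_succ' _ (n + 1), add_sub_right_comm,
        ← sum_sub_distrib]
      congr 1
      · refine sum_congr rfl fun m _ ↦ ?_
        rw [Nat.choose_succ_succ, show m + 1 + a = m + (a + 1) by ring]
        push_cast
        ring
      · simp
    rw [split, ih (a + 1) t (by lia)]
    cases t with
    | zero =>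
      rw [sum_eq_zero fun m hm ↦ ?_]
      · simp [pow_succ]
      · rw [Nat.choose_eq_zero_of_lt (show m + a < s by simp at hm; lia)]
        simp
    | succ t =>
      rw [ih a t (by lia), Nat.choose_succ_succ']
      push_cast
      ring

theorem sum_neg_one_pow_choose_mul_choose_succ (s t : ℕ) :
    ∑ m ∈ range (s + t + 1), (-1 : ℤ) ^ m * m.choose s * (s + t + 1).choose (m + 1) =
      (-1) ^ s := by
  have step (k : ℕ) :
      ∑ m ∈ range (k + 1), (-1 : ℤ) ^ m * m.choose s * (k + 1).choose (m + 1) =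
        ∑ m ∈ range (k + 1), (-1 : ℤ) ^ m * k.choose m * (m + 0).choose s +
          ∑ m ∈ range k, (-1 : ℤ) ^ m * m.choose s * k.choose (m + 1) := by
    have extend : ∑ m ∈ range k, (-1 : ℤ) ^ m * m.choose s * k.choose (m + 1) =
        ∑ m ∈ range (k + 1), (-1 : ℤ) ^ m * m.choose s * k.choose (m + 1) := by
      rw [sum_range_succ]
      simp
    rw [extend, ← sum_add_distrib]
    refine sum_congr rfl fun m _ ↦ ?_
    rw [Nat.choose_succ_succ', add_zero]
    push_cast
    ring
  induction t with
  | zero =>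
    rw [step, sum_neg_one_pow_choose_mul_choose_add _ 0 s 0 (by lia),
      sum_eq_zero (s := range s) fun m hm ↦ ?_]
    · simp
    · rw [Nat.choose_eq_zero_of_lt (by simpa using hm)]
      simp
  | succ t ih =>
    rw [step, sum_neg_one_pow_choose_mul_choose_add _ 0 s (t + 1) (by lia)]
    simpa [← add_assoc] using ih

theorem sum_range_choose_mul_eq {R : Type*} [CommRing R] (s t : ℕ) (u : ℕ → R) :
    ∑ m ∈ range (s + t + 1), (m.choose s : R) * u m =
      ∑ i ∈ range (t + 1), ((s + i).choose s : R) * u (s + i) := by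
  rw [add_assoc, sum_range_add, sum_eq_zero fun m hm ↦ ?_, zero_add]
  rw [Nat.choose_eq_zero_of_lt (by simpa using hm)]
  simp

theorem sum_neg_one_pow_choose_mul_binomial_transform {R : Type*} [CommRing R] (s t : ℕ)
    (f : ℕ → R) :
    ∑ i ∈ range (t + 1), ((s + i).choose s : R) * ((-1) ^ i *
        ∑ j ∈ range (s + i + 2),
          (-1) ^ j * ((s + t + 1 - j).choose (s + i + 1 - j) : R) * f j) =
      f 0 + ∑ i ∈ range (s + 1), ((t + i).choose t : R) * ((-1) ^ (i + 1) * f (t + i + 1)) := by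
  have coeff_zero : ∑ m ∈ range (s + t + 1),
      (m.choose s : R) * ((-1) ^ (m + s) * (s + t + 1).choose (m + 1)) = 1 := by
    have h := congrArg (fun z : ℤ ↦ (-1 : R) ^ s * z)
      (sum_neg_one_pow_choose_mul_choose_succ s t)
    push_cast at h
    rw [← mul_pow, neg_one_mul, neg_neg, one_pow, mul_sum] at h
    refine Eq.trans (sum_congr rfl fun m _ ↦ ?_) h
    ring
  have coeff_succ (j : ℕ) (hj : j ≤ s + t) : ∑ m ∈ range (s + t + 1),
      (if j ≤ m then (m.choose s : R) * ((-1) ^ (m + s) * (s + t - j).choose (m - j)) else 0) =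
        (-1) ^ t * j.choose t := by
    have h := congrArg (fun z : ℤ ↦ (-1 : R) ^ (s + j) * z)
      (sum_neg_one_pow_choose_mul_choose_add (s + t - j) j s t (by lia))
    push_cast at h
    rw [← mul_assoc, ← pow_add, show s + j + (s + t - j) = 2 * s + t by lia, pow_add _ (2 * s), pow_mul _ 2,
      neg_one_sq, one_pow, one_mul, mul_sum] at h
    rw [← h, show s + t + 1 = j + (s + t - j + 1) by lia, sum_range_add,
      sum_eq_zero fun m hm ↦ if_neg (by simpa using hm), zero_add]
    refine sum_congr rfl fun m _ ↦ ?_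
    rw [if_pos (by lia), show j + m - j = m by lia, add_comm j m]
    ring
  have inner (m : ℕ) (hm : m ∈ range (s + t + 1)) :
      ∑ j ∈ range (m + 2), (-1) ^ j * ((s + t + 1 - j).choose (m + 1 - j) : R) * f j =
        (s + t + 1).choose (m + 1) * f 0 + ∑ j ∈ range (s + t + 1),
          if j ≤ m then (-1) ^ (j + 1) * ((s + t - j).choose (m - j) : R) * f (j + 1) else 0 := by
    rw [sum_range_succ', add_comm, ← sum_filter]
    congr 1
    · simp
    · refine sum_congr ?_ fun j _ ↦ by simp
      ext j
      simp at hm ⊢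
      lia
  calc
    _ = ∑ m ∈ range (s + t + 1), (m.choose s : R) * ((-1) ^ (m + s) *
        ∑ j ∈ range (m + 2), (-1) ^ j * ((s + t + 1 - j).choose (m + 1 - j) : R) * f j) := by
      rw [sum_range_choose_mul_eq]
      refine sum_congr rfl fun i _ ↦ ?_
      rw [show s + i + s = 2 * s + i by ring, pow_add _ (2 * s), pow_mul, neg_one_sq, one_pow,
        one_mul]
    _ = (∑ m ∈ range (s + t + 1),
          (m.choose s : R) * ((-1) ^ (m + s) * (s + t + 1).choose (m + 1))) * f 0 +
        ∑ j ∈ range (s + t + 1), (∑ m ∈ range (s + t + 1),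
          if j ≤ m then (m.choose s : R) * ((-1) ^ (m + s) * (s + t - j).choose (m - j)) else 0) *
            ((-1) ^ (j + 1) * f (j + 1)) := by
      simp_rw [sum_mul]
      rw [sum_comm (s := range (s + t + 1)), ← sum_add_distrib]
      refine sum_congr rfl fun m hm ↦ ?_
      rw [inner m hm, mul_add, mul_add, mul_sum, mul_sum]
      congr 1
      · ring
      · refine sum_congr rfl fun j _ ↦ ?_
        split_ifs <;> ring
    _ = _ := by
      rw [coeff_zero, one_mul]
      congr 1
      rw [sum_congr rfl fun j hj ↦ by
        rw [coeff_succ j (by simp at hj; lia), mul_comm ((-1) ^ t) (j.choose t : R), mul_assoc]]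
      rw [add_comm s t, sum_range_choose_mul_eq t s fun j ↦ (-1) ^ t * ((-1) ^ (j + 1) * f (j + 1))]
      refine sum_congr rfl fun i _ ↦ ?_
      rw [← mul_assoc ((-1) ^ t), ← pow_add, show t + (t + i + 1) = 2 * t + (i + 1) by ring,
        pow_add _ (2 * t), pow_mul, neg_one_sq, one_pow, one_mul]

theorem Fp_zero {k : ℤ} (hk : 0 ≤ k) : Fp 0 k = 1 := by
  simp [Fp, hk]

theorem Ehat_natCast {p k : ℕ} (h : p ≤ k) :
    Ehat p k = ∑ i ∈ range (p + 1), (-1 : P) ^ i * ((k - i).choose (p - i) : P) * Fp i k := by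
  simp [Ehat, h]

theorem sum_Icc_int_eq_sum_range {M : Type*} [AddCommMonoid M] (a : ℤ) (n : ℕ) (f : ℤ → M) :
    ∑ i ∈ Icc a (a + n), f i = ∑ i ∈ range (n + 1), f (a + i) := by
  symm
  refine sum_bij (fun i _ ↦ a + (i : ℤ)) (fun i hi ↦ ?_) (fun i _ j _ h ↦ ?_) (fun i hi ↦ ?_)
    fun _ _ ↦ rfl
  · simp at hi ⊢
    lia
  · lia
  · simp at hi
    exact ⟨(i - a).toNat, by simp; lia, by lia⟩

/-- For all integers `1 ≤ p ≤ k`,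
`Σ_{i=p}^k (−1)^{i−p} C(i−1, p−1) Ê_i^k = 1 + Σ_{i=k−p+1}^k (−1)^{i−k+p} C(i−1, k−p) F_i^k`. -/
theorem statement7 (p k : ℤ) (hp : 1 ≤ p) (hpk : p ≤ k) :
    ∑ i ∈ Finset.Icc p k,
        (-1 : P) ^ (i - p).toNat * (Nat.choose (i - 1).toNat (p - 1).toNat : P) * Ehat i k =
    1 + ∑ i ∈ Finset.Icc (k - p + 1) k,
        (-1 : P) ^ (i - k + p).toNat * (Nat.choose (i - 1).toNat (k - p).toNat : P) * Fp i k := by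
  obtain ⟨s, rfl⟩ : ∃ s : ℕ, p = s + 1 := ⟨(p - 1).toNat, by lia⟩
  obtain ⟨t, rfl⟩ : ∃ t : ℕ, k = s + 1 + t := ⟨(k - (s + 1)).toNat, by lia⟩
  have key := sum_neg_one_pow_choose_mul_binomial_transform s t
    fun j ↦ Fp j ((s + t + 1 : ℕ) : ℤ)
  rw [sum_Icc_int_eq_sum_range, show (s + 1 + t - (s + 1) + 1 : ℤ) = t + 1 by ring,
    show (s + 1 + t : ℤ) = t + 1 + s by ring, sum_Icc_int_eq_sum_range,
    show (t + 1 + s : ℤ) = (s + t + 1 : ℕ) by push_cast; ring]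
  rw [Nat.cast_zero, Fp_zero (by lia)] at key
  convert key using 1
  · refine sum_congr rfl fun i hi ↦ ?_
    rw [show (s + 1 + i : ℤ) = (s + i + 1 : ℕ) by push_cast; ring,
      Ehat_natCast (by simp at hi; lia),
      show (((s + i + 1 : ℕ) : ℤ) - (s + 1)).toNat = i by lia,
      show (((s + i + 1 : ℕ) : ℤ) - 1).toNat = s + i by lia,
      show ((s + 1 : ℤ) - 1).toNat = s by lia]
    rw [mul_comm ((-1 : P) ^ i), mul_assoc]
  · refine congrArg (1 + ·) (sum_congr rfl fun i _ ↦ ?_)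
    rw [show (t + 1 + i : ℤ) = (t + i + 1 : ℕ) by push_cast; ring,
      show (((t + i + 1 : ℕ) : ℤ) - (s + t + 1 : ℕ) + (s + 1)).toNat = i + 1 by lia,
      show (((t + i + 1 : ℕ) : ℤ) - 1).toNat = t + i by lia,
      show (((s + t + 1 : ℕ) : ℤ) - (s + 1)).toNat = t by lia]
    rw [mul_comm ((-1 : P) ^ (i + 1)), mul_assoc]
end
end

section
/- For all integers p, k with 0 ≤ p ≤ k, the specialization of Ê_p^k obtained by setting every variable q_i to 0 equals the elementary symmetric polynomial e_p(x_1, …, x_k). -/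
open MvPolynomial Finset

noncomputable section

/-- The substitution setting every variable `q_i` to `0`. -/
def setAllQ : P →ₐ[ℤ] P :=
  aeval (Sum.elim (fun _ => (0 : P)) (fun i => xv i))

/-- The elementary symmetric sums of `f` over `s`, expanded in those of `1 - f`. -/
theorem sum_powersetCard_prod_eq_sum_choose {ι R : Type*} [DecidableEq ι] [CommRing R]
    (s : Finset ι) (n : ℕ) (f : ι → R) :
    ∑ J ∈ s.powersetCard n, ∏ i ∈ J, f i =
      ∑ j ∈ Finset.range (n + 1), (-1) ^ j * ((#s - j).choose (n - j) : R) *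
        ∑ I ∈ s.powersetCard j, ∏ i ∈ I, (1 - f i) := by
  have expand (J : Finset ι) (hJ : J ∈ s.powersetCard n) : ∏ i ∈ J, f i =
      ∑ j ∈ Finset.range (n + 1), ∑ I ∈ J.powersetCard j, (-1) ^ j * ∏ i ∈ I, (1 - f i) := by
    calc ∏ i ∈ J, f i = ∏ i ∈ J, (1 + -(1 - f i)) := prod_congr rfl fun i _ => by ring
      _ = _ := by
        rw [prod_one_add, sum_powerset, (mem_powersetCard.mp hJ).2]
        refine sum_congr rfl fun j _ => sum_congr rfl fun I hI => ?_
        rw [prod_neg, (mem_powersetCard.mp hI).2]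
  rw [sum_congr rfl expand, sum_comm]
  refine sum_congr rfl fun j hj => ?_
  rw [sum_comm' (t' := s.powersetCard j) (s' := fun I => (s.powersetCard n).filter (I ⊆ ·)),
    mul_sum]
  · refine sum_congr rfl fun I hI => ?_
    obtain ⟨hIs, rfl⟩ := mem_powersetCard.mp hI
    rw [sum_const, card_filter_powersetCard_subset _ _ _ hIs (mem_range_succ_iff.mp hj),
      nsmul_eq_mul]
    ring
  · intro J I
    simp only [mem_powersetCard, mem_filter]
    exact ⟨fun ⟨⟨hJ, hn⟩, hI, hc⟩ => ⟨⟨⟨hJ, hn⟩, hI⟩, hI.trans hJ, hc⟩,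
      fun ⟨⟨⟨hJ, hn⟩, hI⟩, _, hc⟩ => ⟨⟨hJ, hn⟩, hI, hc⟩⟩

@[simp]
theorem setAllQ_qv (i : ℕ) : setAllQ (qv i) = 0 := by
  simp [setAllQ, qv]

@[simp]
theorem setAllQ_xv (i : ℕ) : setAllQ (xv i) = xv i := by
  simp [setAllQ, xv]

theorem setAllQ_Fp {p k : ℕ} (h : p ≤ k) :
    setAllQ (Fp p k) = ∑ I ∈ (Finset.Icc 1 k).powersetCard p, ∏ i ∈ I, (1 - xv i) := by
  simp [Fp, h]

/-- For all integers `0 ≤ p ≤ k`, the specialization of `Ê_p^k` at `q_1 = q_2 = ⋯ = 0`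
is the elementary symmetric polynomial `e_p(x_1, …, x_k)`. -/
theorem statement8 (p k : ℤ) (hp : 0 ≤ p) (hpk : p ≤ k) :
    setAllQ (Ehat p k) =
      ∑ I ∈ (Finset.Icc 1 k.toNat).powersetCard p.toNat, ∏ i ∈ I, xv i := by
  lift p to ℕ using hp
  lift k to ℕ using hpk.trans' (Int.natCast_nonneg p)
  have hpk' : p ≤ k := Int.ofNat_le.mp hpk
  rw [sum_powersetCard_prod_eq_sum_choose, Ehat, if_pos ⟨Int.natCast_nonneg p, hpk⟩, map_sum]
  refine sum_congr (by simp) fun i hi => ?_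
  have hik : i ≤ k := (mem_range_succ_iff.mp hi).trans hpk'
  simp [setAllQ_Fp hik]
end
end

section
/- For all integers p, k with 0 ≤ p ≤ k, with respect to the weighted grading on ℤ[q_1, q_2, …, x_1, x_2, …] given by deg(x_i) = 1 and deg(q_i) = 2: (a) every weighted homogeneous component of Ê_p^k of degree strictly less than p is zero, and (b) the weighted homogeneous component of Ê_p^k of degree p equals the quantum elementary polynomial E_p^k. In other words, the lowest homogeneous component of Ê_p^k is E_p^k. -/
open MvPolynomial Finset

noncomputable section

/-- The weight function giving `deg(x_i) = 1` and `deg(q_i) = 2`. -/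
def wt : ℕ ⊕ ℕ → ℕ := Sum.elim (fun _ => 2) (fun _ => 1)

/-- The Givental–Kim tridiagonal matrix `Γ_k`, with diagonal `x_1, …, x_k`, superdiagonal
`q_1, …, q_{k−1}`, and subdiagonal entries `−1`. -/
def Gam (k : ℕ) : Matrix (Fin k) (Fin k) P := fun i j =>
  if (i : ℕ) = (j : ℕ) then xv ((i : ℕ) + 1)
  else if (j : ℕ) = (i : ℕ) + 1 then qv ((i : ℕ) + 1)
  else if (i : ℕ) = (j : ℕ) + 1 then -1
  else 0

/-- The quantum elementary polynomial `E_p^k`: the coefficient of `λ^p` in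
`det(I_k + λ·Γ_k)`. -/
def Equant (p k : ℕ) : P :=
  (Matrix.det ((1 : Matrix (Fin k) (Fin k) (Polynomial P)) +
      (Polynomial.X : Polynomial P) • (Gam k).map Polynomial.C)).coeff p

/-- The sum over `I ⊆ {1, …, k}` of `u ^ (k - |I|)` times the product of the `a i` with `i ∈ I`
and the `b i` with `i ∈ I`, `i + 1 ∉ I`. -/
def blockSum {R : Type*} [CommRing R] (u : R) (a b : ℕ → R) (k : ℕ) : R :=
  ∑ I ∈ (Finset.Icc 1 k).powerset,
    u ^ (k - #I) * ((∏ i ∈ I, a i) * ∏ i ∈ I.filter (fun i => i + 1 ∉ I), b i)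

section BlockSum

variable {R : Type*} [CommRing R] (u : R) (a b : ℕ → R)

theorem blockSum_zero : blockSum u a b 0 = 1 := by
  simp [blockSum]

theorem blockSum_congr {b b' : ℕ → R} {k : ℕ} (h : ∀ i ≤ k, b i = b' i) :
    blockSum u a b k = blockSum u a b' k := by
  refine Finset.sum_congr rfl fun I hI => ?_
  congr 2
  refine Finset.prod_congr rfl fun i hi => h i ?_
  exact (Finset.mem_Icc.1 (Finset.mem_powerset.1 hI (Finset.mem_filter.1 hi).1)).2

theorem blockSum_succ (k : ℕ) :
    blockSum u a b (k + 1) =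
      u * blockSum u a b k + a (k + 1) * b (k + 1) * blockSum u a (Function.update b k 1) k := by
  have hk : k + 1 ∉ Finset.Icc 1 k := by simp
  have hIcc : Finset.Icc 1 (k + 1) = insert (k + 1) (Finset.Icc 1 k) := by
    ext i; simp only [Finset.mem_Icc, Finset.mem_insert]; omega
  rw [blockSum, hIcc, Finset.sum_powerset_insert hk, blockSum, blockSum, Finset.mul_sum,
    Finset.mul_sum]
  congr 1 <;> refine Finset.sum_congr rfl fun I hI => ?_
  · have hcard : #I ≤ k := by simpa using Finset.card_le_card (Finset.mem_powerset.1 hI)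
    rw [Nat.succ_sub hcard, pow_succ]
    ring
  · have hkI : k + 1 ∉ I := fun h => hk (Finset.mem_powerset.1 hI h)
    have hk2 : k + 1 + 1 ∉ insert (k + 1) I := by
      intro h
      rcases Finset.mem_insert.1 h with h | h
      · omega
      · have := (Finset.mem_Icc.1 (Finset.mem_powerset.1 hI h)).2
        omega
    have hprod : ∏ i ∈ I, (if i + 1 ∉ insert (k + 1) I then b i else 1) =
        ∏ i ∈ I, (if i + 1 ∉ I then Function.update b k 1 i else 1) := by
      refine Finset.prod_congr rfl fun i _ => ?_
      by_cases hik : i = k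
      · subst hik; simp
      · simp [Finset.mem_insert, hik]
    rw [Finset.card_insert_of_notMem hkI, Nat.add_sub_add_right, Finset.prod_insert hkI,
      Finset.prod_filter, Finset.prod_insert hkI, if_pos hk2, hprod, Finset.prod_filter]
    ring

/-- Splitting off the factor `b k` from `blockSum`. -/
theorem blockSum_eq_update (k : ℕ) :
    blockSum u a b (k + 1) = blockSum u a (Function.update b (k + 1) 1) (k + 1) +
      a (k + 1) * (b (k + 1) - 1) * blockSum u a (Function.update b k 1) k := by
  have h₁ : blockSum u a (Function.update b (k + 1) 1) k = blockSum u a b k :=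
    blockSum_congr u a fun i hi => Function.update_of_ne (by omega) _ _
  have h₂ : blockSum u a (Function.update (Function.update b (k + 1) 1) k 1) k =
      blockSum u a (Function.update b k 1) k :=
    blockSum_congr u a fun i hi => by
      simp [Function.update_apply, show i ≠ k + 1 by omega]
  rw [blockSum_succ, blockSum_succ, h₁, h₂, Function.update_self]
  ring

theorem blockSum_update_one :
    blockSum u a (Function.update b 1 1) 1 = u + a 1 := by
  rw [blockSum_succ, blockSum_zero, blockSum_zero]
  simp

theorem blockSum_update_add_two (k : ℕ) :
    blockSum u a (Function.update b (k + 2) 1) (k + 2) =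
      (u + a (k + 2)) * blockSum u a (Function.update b (k + 1) 1) (k + 1) +
        u * (a (k + 1) * (b (k + 1) - 1)) * blockSum u a (Function.update b k 1) k := by
  have h₁ : blockSum u a (Function.update b (k + 2) 1) (k + 1) = blockSum u a b (k + 1) :=
    blockSum_congr u a fun i hi => Function.update_of_ne (by omega) _ _
  have h₂ : blockSum u a (Function.update (Function.update b (k + 2) 1) (k + 1) 1) (k + 1) =
      blockSum u a (Function.update b (k + 1) 1) (k + 1) :=
    blockSum_congr u a fun i hi => by
      simp [Function.update_apply, show i ≠ k + 2 by omega]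
  rw [blockSum_succ u a _ (k + 1), h₁, h₂, Function.update_self, blockSum_eq_update]
  ring

end BlockSum

/-- The three-term recurrence for determinants of tridiagonal matrices. -/
theorem det_tridiagonal_add_two {R : Type*} [CommRing R] (m : ℕ → ℕ → R)
    (hlow : ∀ i j, j + 1 < i → m i j = 0) (hup : ∀ i j, i + 1 < j → m i j = 0) (k : ℕ) :
    Matrix.det (Matrix.of fun i j : Fin (k + 2) => m i j) =
      m (k + 1) (k + 1) * Matrix.det (Matrix.of fun i j : Fin (k + 1) => m i j) -
        m (k + 1) k * m k (k + 1) * Matrix.det (Matrix.of fun i j : Fin k => m i j) := by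
  have hminor : Matrix.det ((Matrix.of fun i j : Fin (k + 2) => m i j).submatrix
      (Fin.last (k + 1)).succAbove (Fin.last k).castSucc.succAbove) =
        m k (k + 1) * Matrix.det (Matrix.of fun i j : Fin k => m i j) := by
    rw [Matrix.det_succ_column _ (Fin.last k), Fin.sum_univ_castSucc, Finset.sum_eq_zero]
    · have hsub : (((Matrix.of fun i j : Fin (k + 2) => m i j).submatrix
          (Fin.last (k + 1)).succAbove (Fin.last k).castSucc.succAbove).submatrix
            (Fin.last k).succAbove (Fin.last k).succAbove) =
          Matrix.of fun i j : Fin k => m i j := by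
        ext i j
        simp [Fin.succAbove_of_castSucc_lt, Fin.lt_def]
      rw [hsub]
      simp [← two_mul, pow_mul]
    · intro i _
      have := i.2
      simp [hup i (k + 1) (by omega)]
  rw [Matrix.det_succ_row _ (Fin.last (k + 1)), Fin.sum_univ_castSucc, Fin.sum_univ_castSucc,
    Finset.sum_eq_zero, hminor]
  · have hsub : (Matrix.of fun i j : Fin (k + 2) => m i j).submatrix
        (Fin.last (k + 1)).succAbove (Fin.last (k + 1)).succAbove =
        Matrix.of fun i j : Fin (k + 1) => m i j := by
      ext i j
      simp
    rw [hsub]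
    have hsign : (-1 : R) ^ (k + 1 + k) = -1 := Odd.neg_one_pow ⟨k, by ring⟩
    have hsign' : (-1 : R) ^ (k + 1 + (k + 1)) = 1 := Even.neg_one_pow ⟨k + 1, rfl⟩
    simp only [Matrix.of_apply, Fin.val_last, Fin.val_castSucc, hsign, hsign']
    ring
  · intro j _
    have := j.2
    simp [hlow (k + 1) j (by omega)]

/-- The generating polynomial `det(I_k + λ·Γ_k)` of the quantum elementary polynomials. -/
def quantGen (k : ℕ) : Polynomial P :=
  Matrix.det ((1 : Matrix (Fin k) (Fin k) (Polynomial P)) +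
    (Polynomial.X : Polynomial P) • (Gam k).map Polynomial.C)

theorem quantGen_zero : quantGen 0 = 1 := by
  simp [quantGen]

theorem quantGen_one : quantGen 1 = 1 + Polynomial.C (xv 1) * Polynomial.X ^ 1 := by
  rw [quantGen, Matrix.det_unique]
  simp [Gam, Polynomial.X_mul_C]

theorem quantGen_add_two (k : ℕ) :
    quantGen (k + 2) = (1 + Polynomial.C (xv (k + 2)) * Polynomial.X ^ 1) * quantGen (k + 1) +
      Polynomial.C (qv (k + 1)) * Polynomial.X ^ 2 * quantGen k := by
  let m : ℕ → ℕ → Polynomial P := fun i j =>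
    if i = j then 1 + Polynomial.X * Polynomial.C (xv (i + 1))
    else if j = i + 1 then Polynomial.X * Polynomial.C (qv (i + 1))
    else if i = j + 1 then Polynomial.X * -1
    else 0
  have hm : ∀ n, quantGen n = Matrix.det (Matrix.of fun i j : Fin n => m i j) := by
    intro n
    rw [quantGen]
    congr 1
    ext1 i j
    simp only [Matrix.add_apply, Matrix.smul_apply, Matrix.map_apply, Gam, Matrix.of_apply, m,
      Matrix.one_apply, Fin.ext_iff, smul_eq_mul]
    split_ifs <;> simp
  rw [hm, hm, hm, det_tridiagonal_add_two]
  · have hdiag : m (k + 1) (k + 1) = 1 + Polynomial.X * Polynomial.C (xv (k + 2)) := if_pos rfl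
    have hsub : m (k + 1) k = Polynomial.X * -1 := by
      simp only [m]
      rw [if_neg (by omega), if_neg (by omega), if_pos trivial]
    have hsuper : m k (k + 1) = Polynomial.X * Polynomial.C (qv (k + 1)) := by simp [m]
    rw [hdiag, hsub, hsuper]
    ring
  · intro i j h
    simp only [m]
    rw [if_neg (by omega), if_neg (by omega), if_neg (by omega)]
  · intro i j h
    simp only [m]
    rw [if_neg (by omega), if_neg (by omega), if_neg (by omega)]

/-- The polynomials in `λ` whose coefficient of `λ ^ p` lies in `V p` for all `p`. -/
def gradedCoeffs (V : ℕ → Submodule ℤ P) : AddSubgroup (Polynomial P) where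
  carrier := {f | ∀ p, f.coeff p ∈ V p}
  add_mem' hf hg p := by
    rw [Polynomial.coeff_add]
    exact add_mem (hf p) (hg p)
  zero_mem' p := by
    rw [Polynomial.coeff_zero]
    exact zero_mem _
  neg_mem' hf p := by
    rw [Polynomial.coeff_neg]
    exact neg_mem (hf p)

theorem mul_mem_gradedCoeffs {U V W : ℕ → Submodule ℤ P} (h : ∀ i j, U i * V j ≤ W (i + j))
    {f g : Polynomial P} (hf : f ∈ gradedCoeffs U) (hg : g ∈ gradedCoeffs V) :
    f * g ∈ gradedCoeffs W := by
  intro p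
  rw [Polynomial.coeff_mul]
  refine sum_mem fun ij hij => ?_
  rw [← Finset.HasAntidiagonal.mem_antidiagonal.1 hij]
  exact h _ _ (Submodule.mul_mem_mul (hf _) (hg _))

theorem C_mul_X_pow_mem_gradedCoeffs {V : ℕ → Submodule ℤ P} {f : P} {n : ℕ} (hf : f ∈ V n) :
    Polynomial.C f * Polynomial.X ^ n ∈ gradedCoeffs V := by
  intro p
  rw [Polynomial.coeff_C_mul_X_pow]
  split_ifs with h
  · exact h ▸ hf
  · exact zero_mem _

theorem one_mem_gradedCoeffs {V : ℕ → Submodule ℤ P} (h : 1 ∈ V 0) : 1 ∈ gradedCoeffs V := by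
  simpa using C_mul_X_pow_mem_gradedCoeffs h

/-- The polynomials all of whose monomials have weight at least `n`. -/
def highWeight (n : ℕ) : Submodule ℤ P :=
  restrictSupport ℤ {m | n ≤ Finsupp.weight wt m}

theorem highWeight_mul (i j : ℕ) : highWeight i * highWeight j ≤ highWeight (i + j) := by
  rw [highWeight, highWeight, ← restrictSupport_add]
  refine restrictSupport_mono ℤ ?_
  rintro _ ⟨m, hm, n, hn, rfl⟩
  simpa using add_le_add hm hn

theorem highWeight_antitone : Antitone highWeight := fun _ _ h =>
  restrictSupport_mono ℤ fun _ hm => le_trans h hm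

theorem weightedHomogeneousSubmodule_le_highWeight (n : ℕ) :
    weightedHomogeneousSubmodule ℤ wt n ≤ highWeight n := fun _ hf _ hm =>
  (hf (mem_support_iff.1 hm)).ge

theorem xv_mem_weightedHomogeneousSubmodule (i : ℕ) :
    xv i ∈ weightedHomogeneousSubmodule ℤ wt 1 :=
  isWeightedHomogeneous_X ℤ wt (Sum.inr i)

theorem qv_mem_weightedHomogeneousSubmodule (i : ℕ) :
    qv i ∈ weightedHomogeneousSubmodule ℤ wt 2 :=
  isWeightedHomogeneous_X ℤ wt (Sum.inl i)

theorem one_mem_weightedHomogeneousSubmodule :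
    (1 : P) ∈ weightedHomogeneousSubmodule ℤ wt 0 :=
  isWeightedHomogeneous_one ℤ wt

theorem weightedHomogeneousComponent_eq_zero_of_mem_highWeight {f : P} {n d : ℕ}
    (hf : f ∈ highWeight n) (hd : d < n) : weightedHomogeneousComponent wt d f = 0 :=
  weightedHomogeneousComponent_eq_zero' d f fun _ hm => (lt_of_lt_of_le hd (hf hm)).ne'

theorem quantGen_mem_gradedCoeffs (k : ℕ) :
    quantGen k ∈ gradedCoeffs (weightedHomogeneousSubmodule ℤ wt) := by
  have hmul := fun i j => weightedHomogeneousSubmodule_mul (R := ℤ) wt i j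
  have hone := one_mem_gradedCoeffs one_mem_weightedHomogeneousSubmodule
  have hx := fun i => C_mul_X_pow_mem_gradedCoeffs (xv_mem_weightedHomogeneousSubmodule i)
  induction k using Nat.twoStepInduction with
  | zero => exact quantGen_zero ▸ hone
  | one => exact quantGen_one ▸ add_mem hone (hx 1)
  | more k ih₁ ih₂ =>
    rw [quantGen_add_two]
    exact add_mem (mul_mem_gradedCoeffs hmul (add_mem hone (hx _)) ih₂)
      (mul_mem_gradedCoeffs hmul
        (C_mul_X_pow_mem_gradedCoeffs (qv_mem_weightedHomogeneousSubmodule _)) ih₁)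

/-- The polynomials in `λ` whose coefficient of `λ ^ p` has only monomials of weight at least
`p + c`. -/
def highCoeffs (c : ℕ) : AddSubgroup (Polynomial P) :=
  gradedCoeffs fun p => highWeight (p + c)

theorem highCoeffs_one_le : highCoeffs 1 ≤ highCoeffs 0 := fun _ hf p =>
  highWeight_antitone (Nat.le_succ p) (hf p)

theorem mul_mem_highCoeffs {c d : ℕ} {f g : Polynomial P} (hf : f ∈ highCoeffs c)
    (hg : g ∈ highCoeffs d) : f * g ∈ highCoeffs (c + d) :=
  mul_mem_gradedCoeffs (W := fun p => highWeight (p + (c + d)))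
    (fun i j => (highWeight_mul _ _).trans (highWeight_antitone (by omega))) hf hg

theorem quantGen_mem_highCoeffs (k : ℕ) : quantGen k ∈ highCoeffs 0 := fun p =>
  weightedHomogeneousSubmodule_le_highWeight p (quantGen_mem_gradedCoeffs k p)

theorem C_mul_X_pow_mem_highCoeffs {f : P} {w n c : ℕ}
    (hf : f ∈ weightedHomogeneousSubmodule ℤ wt w) (h : n + c ≤ w) :
    Polynomial.C f * Polynomial.X ^ n ∈ highCoeffs c :=
  C_mul_X_pow_mem_gradedCoeffs
    (highWeight_antitone h (weightedHomogeneousSubmodule_le_highWeight w hf))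

theorem one_mem_highCoeffs : 1 ∈ highCoeffs 0 := quantGen_zero ▸ quantGen_mem_highCoeffs 0

/-- The generating polynomial of the `Ê_p^k`, with `q_i` replaced by `1 - b i`. -/
def hatGen (b : ℕ → Polynomial P) (k : ℕ) : Polynomial P :=
  blockSum (1 + Polynomial.X) (fun i => -Polynomial.X * Polynomial.C (1 - xv i)) b k

theorem coeff_hatGen {p k : ℕ} (hpk : p ≤ k) :
    (hatGen (fun i => Polynomial.C (1 - qv i)) k).coeff p = Ehat p k := by
  have hterm : ∀ I ∈ (Finset.Icc 1 k).powerset,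
      ((1 + Polynomial.X : Polynomial P) ^ (k - #I) *
        ((∏ i ∈ I, (-Polynomial.X * Polynomial.C (1 - xv i))) *
          ∏ i ∈ I.filter (fun i => i + 1 ∉ I), Polynomial.C (1 - qv i))).coeff p =
      if #I ≤ p then (-1 : P) ^ #I * (Nat.choose (k - #I) (p - #I) : P) *
        ((∏ i ∈ I, (1 - xv i)) * ∏ i ∈ I.filter (fun i => i + 1 ∉ I), (1 - qv i)) else 0 := by
    intro I _
    have : (1 + Polynomial.X : Polynomial P) ^ (k - #I) *
        ((∏ i ∈ I, (-Polynomial.X * Polynomial.C (1 - xv i))) *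
          ∏ i ∈ I.filter (fun i => i + 1 ∉ I), Polynomial.C (1 - qv i)) =
        Polynomial.C ((-1 : P) ^ #I * ((∏ i ∈ I, (1 - xv i)) *
          ∏ i ∈ I.filter (fun i => i + 1 ∉ I), (1 - qv i))) *
          (Polynomial.X ^ #I * (1 + Polynomial.X) ^ (k - #I)) := by
      rw [Finset.prod_mul_distrib, Finset.prod_const, neg_pow (Polynomial.X : Polynomial P),
        map_mul, map_mul, map_pow, map_prod, map_prod, Polynomial.C_neg, Polynomial.C_1]
      ring
    rw [this, Polynomial.coeff_C_mul, Polynomial.coeff_X_pow_mul',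
      Polynomial.coeff_one_add_X_pow]
    split_ifs <;> ring
  rw [hatGen, blockSum, Polynomial.finsetSum_coeff, Finset.sum_congr rfl hterm,
    Finset.sum_powerset, Nat.card_Icc, Nat.add_sub_cancel, Ehat,
    if_pos ⟨Int.natCast_nonneg p, Int.ofNat_le.2 hpk⟩, Int.toNat_natCast, Int.toNat_natCast]
  symm
  refine Finset.sum_subset_zero_on_sdiff (Finset.range_subset_range.2 (by omega)) ?_ ?_
  · intro i hi
    simp only [Finset.mem_sdiff, Finset.mem_range] at hi
    refine Finset.sum_eq_zero fun I hI => if_neg ?_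
    rw [(Finset.mem_powersetCard.1 hI).2]
    omega
  · intro i hi
    have hip : i ≤ p := Nat.lt_succ_iff.1 (Finset.mem_range.1 hi)
    rw [Fp, if_pos ⟨Int.natCast_nonneg i, Int.ofNat_le.2 (hip.trans hpk)⟩, Finset.mul_sum,
      Int.toNat_natCast, Int.toNat_natCast]
    refine Finset.sum_congr rfl fun I hI => ?_
    rw [(Finset.mem_powersetCard.1 hI).2, if_pos hip]

theorem hatGen_update_sub_quantGen_mem (k : ℕ) :
    hatGen (Function.update (fun i => Polynomial.C (1 - qv i)) k 1) k - quantGen k ∈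
      highCoeffs 1 := by
  induction k using Nat.twoStepInduction with
  | zero =>
    rw [hatGen, blockSum_zero, quantGen_zero, sub_self]
    exact zero_mem _
  | one =>
    rw [hatGen, blockSum_update_one, quantGen_one, map_sub, map_one]
    convert zero_mem (highCoeffs 1) using 1
    ring
  | more k ih₁ ih₂ =>
    have hx := xv_mem_weightedHomogeneousSubmodule
    have hq := qv_mem_weightedHomogeneousSubmodule (k + 1)
    have hqx : qv (k + 1) * xv (k + 1) ∈ weightedHomogeneousSubmodule ℤ wt 3 :=
      IsWeightedHomogeneous.mul hq (hx (k + 1))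
    rw [hatGen] at ih₁ ih₂ ⊢
    have hB := add_mem (highCoeffs_one_le ih₁) (quantGen_mem_highCoeffs k)
    rw [sub_add_cancel] at hB
    rw [blockSum_update_add_two, quantGen_add_two]
    have h₁ := mul_mem_highCoeffs (add_mem one_mem_highCoeffs
      (C_mul_X_pow_mem_highCoeffs (n := 1) (c := 0) (hx (k + 2)) le_rfl)) ih₂
    have h₂ := mul_mem_highCoeffs (C_mul_X_pow_mem_highCoeffs (n := 2) (c := 0) hq le_rfl) ih₁
    have h₃ := mul_mem_highCoeffs (sub_mem (sub_mem
      (C_mul_X_pow_mem_highCoeffs (n := 1) (c := 1) hq le_rfl)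
      (C_mul_X_pow_mem_highCoeffs (n := 1) (c := 1) hqx (by norm_num)))
      (C_mul_X_pow_mem_highCoeffs (n := 2) (c := 1) hqx le_rfl)) hB
    convert add_mem (add_mem h₁ h₂) h₃ using 1
    simp only [map_sub, map_one, map_mul]
    ring

theorem hatGen_sub_quantGen_mem (k : ℕ) :
    hatGen (fun i => Polynomial.C (1 - qv i)) k - quantGen k ∈ highCoeffs 1 := by
  cases k with
  | zero =>
    rw [hatGen, blockSum_zero, quantGen_zero, sub_self]
    exact zero_mem _
  | succ k =>
    have hq := qv_mem_weightedHomogeneousSubmodule (k + 1)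
    have hqx : qv (k + 1) * xv (k + 1) ∈ weightedHomogeneousSubmodule ℤ wt 3 :=
      IsWeightedHomogeneous.mul hq (xv_mem_weightedHomogeneousSubmodule (k + 1))
    have ih := hatGen_update_sub_quantGen_mem k
    have h₁ := hatGen_update_sub_quantGen_mem (k + 1)
    rw [hatGen] at ih h₁ ⊢
    have hB := add_mem (highCoeffs_one_le ih) (quantGen_mem_highCoeffs k)
    rw [sub_add_cancel] at hB
    rw [blockSum_eq_update]
    have h₂ := mul_mem_highCoeffs (sub_mem
      (C_mul_X_pow_mem_highCoeffs (n := 1) (c := 1) hq le_rfl)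
      (C_mul_X_pow_mem_highCoeffs (n := 1) (c := 1) hqx (by norm_num))) hB
    convert add_mem h₁ h₂ using 1
    simp only [map_sub, map_one, map_mul]
    ring

/-- For all integers `0 ≤ p ≤ k`, with respect to the weighted grading `deg(x_i) = 1`,
`deg(q_i) = 2`: every weighted homogeneous component of `Ê_p^k` of degree `< p` vanishes,
and the weighted homogeneous component of degree `p` equals the quantum elementary
polynomial `E_p^k`; i.e., the lowest homogeneous component of `Ê_p^k` is `E_p^k`. -/
theorem statement9 (p k : ℤ) (hp : 0 ≤ p) (hpk : p ≤ k) :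
    (∀ d : ℕ, (d : ℤ) < p → weightedHomogeneousComponent wt d (Ehat p k) = 0) ∧
    weightedHomogeneousComponent wt p.toNat (Ehat p k) = Equant p.toNat k.toNat := by
  lift p to ℕ using hp
  lift k to ℕ using hpk.trans' (Int.natCast_nonneg p)
  have hpk' : p ≤ k := Int.ofNat_le.1 hpk
  have hhigh : Ehat p k - Equant p k ∈ highWeight (p + 1) := by
    rw [← coeff_hatGen hpk']
    have h := hatGen_sub_quantGen_mem k p
    rwa [Polynomial.coeff_sub] at h
  have hhom : IsWeightedHomogeneous wt (Equant p k) p := quantGen_mem_gradedCoeffs k p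
  have hsplit : Ehat p k = Equant p k + (Ehat p k - Equant p k) := by ring
  rw [Int.toNat_natCast, Int.toNat_natCast, hsplit]
  refine ⟨fun d hd => ?_, ?_⟩
  · have hdp : d < p := Int.ofNat_lt.1 hd
    rw [map_add, hhom.weightedHomogeneousComponent_ne d hdp.ne,
      weightedHomogeneousComponent_eq_zero_of_mem_highWeight hhigh (by omega), add_zero]
  · rw [map_add, hhom.weightedHomogeneousComponent_same,
      weightedHomogeneousComponent_eq_zero_of_mem_highWeight hhigh (by omega), add_zero]
end
end

section
/- For all integers p, k with 0 ≤ p ≤ k, the identity e_p(1 − x_1, 1 − x_2, …, 1 − x_k) = Σ_{i=0}^p (−1)^i C(k−i, p−i) e_i(x_1, …, x_k) holds in ℤ[x_1, x_2, …]. -/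
open MvPolynomial Finset

noncomputable section

/-- The elementary symmetric polynomials of the family `1 - f i` in terms of those of `f i`. -/
theorem sum_powersetCard_prod_one_sub {α R : Type*} [CommRing R] (s : Finset α) (p : ℕ)
    (f : α → R) :
    ∑ I ∈ s.powersetCard p, ∏ i ∈ I, (1 - f i) =
      ∑ i ∈ range (p + 1), (-1) ^ i * ((#s - i).choose (p - i) : R) *
        ∑ J ∈ s.powersetCard i, ∏ j ∈ J, f j := by
  classical
  have expand (I : Finset α) (hI : I ∈ s.powersetCard p) : ∏ i ∈ I, (1 - f i) =
      ∑ i ∈ range (p + 1), ∑ J ∈ I.powersetCard i, (-1) ^ i * ∏ j ∈ J, f j := by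
    simp only [prod_sub, prod_const_one, mul_one]
    rw [sum_powerset, (mem_powersetCard.mp hI).2]
    refine sum_congr rfl fun i _ ↦ sum_congr rfl fun J hJ ↦ ?_
    rw [(mem_powersetCard.mp hJ).2]
  rw [sum_congr rfl expand, sum_comm]
  refine sum_congr rfl fun i hi ↦ ?_
  rw [sum_comm' (t' := s.powersetCard i) (s' := fun J ↦ {I ∈ s.powersetCard p | J ⊆ I}), mul_sum]
  · refine sum_congr rfl fun J hJ ↦ ?_
    obtain ⟨hJs, rfl⟩ := mem_powersetCard.mp hJ
    rw [sum_const, card_filter_powersetCard_subset J s p hJs (mem_range_succ_iff.mp hi),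
      nsmul_eq_mul]
    ring
  · intro I J
    simp only [mem_powersetCard, mem_filter]
    exact ⟨fun h ↦ ⟨⟨h.1, h.2.1⟩, h.2.1.trans h.1.1, h.2.2⟩, fun h ↦ ⟨h.1.1, h.1.2, h.2.2⟩⟩

/-- For all integers `0 ≤ p ≤ k`, in `ℤ[x_1, x_2, …]` (the variable `i` is `x_i`):
`e_p(1 − x_1, …, 1 − x_k) = Σ_{i=0}^p (−1)^i C(k−i, p−i) e_i(x_1, …, x_k)`,
where `e_j` denotes the elementary symmetric polynomial of degree `j`. -/
theorem statement14 (p k : ℕ) (hpk : p ≤ k) :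
    ∑ I ∈ (Finset.Icc 1 k).powersetCard p, ∏ i ∈ I, (1 - X i : MvPolynomial ℕ ℤ) =
    ∑ i ∈ Finset.range (p + 1),
      (-1 : MvPolynomial ℕ ℤ) ^ i * (Nat.choose (k - i) (p - i) : MvPolynomial ℕ ℤ) *
        ∑ I ∈ (Finset.Icc 1 k).powersetCard i, ∏ j ∈ I, (X j : MvPolynomial ℕ ℤ) := by
  simpa using sum_powersetCard_prod_one_sub (Icc 1 k) p (X : ℕ → MvPolynomial ℕ ℤ)
end
end

section
/- In the Fomin–Kirillov quantum quadratic algebra 𝓔_n^q over R, the multiplicative Dunkl elements X_1, …, X_n pairwise commute: X_k · X_l = X_l · X_k for all 1 ≤ k, l ≤ n. -/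
noncomputable section

set_option maxHeartbeats 1000000

/-- The polynomial ring `ℤ[q_1, …, q_{n−1}]`; the variable `i : Fin (n−1)` is `q_{i+1}`. -/
abbrev QPoly (n : ℕ) := MvPolynomial (Fin (n - 1)) ℤ

/-- The multiplicative set generated by the elements `1 − q_i`. -/
def qSubmonoid (n : ℕ) : Submonoid (QPoly n) :=
  Submonoid.closure (Set.range fun i : Fin (n - 1) => 1 - MvPolynomial.X i)

/-- `R = ℤ[q_1, …, q_{n−1}][(1−q_1)⁻¹, …, (1−q_{n−1})⁻¹]`. -/
abbrev QRing (n : ℕ) := Localization (qSubmonoid n)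

/-- The element `q_i` of `R` (for `1 ≤ i ≤ n−1`; junk value `0` otherwise). -/
def qElt (n : ℕ) (i : ℕ) : QRing n :=
  if h : i - 1 < n - 1 then
    algebraMap (QPoly n) (QRing n) (MvPolynomial.X ⟨i - 1, h⟩)
  else 0

/-- The element `(1 − q_i)⁻¹` of `R` (for `1 ≤ i ≤ n−1`; junk value `1` otherwise). -/
def qInvElt (n : ℕ) (i : ℕ) : QRing n :=
  if h : i - 1 < n - 1 then
    Localization.mk 1
      ⟨1 - MvPolynomial.X ⟨i - 1, h⟩, Submonoid.subset_closure ⟨⟨i - 1, h⟩, rfl⟩⟩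
  else 1

/-- Index type for the generators `[i,j]` with `1 ≤ i < j ≤ n` (the generators with `i > j`
are obtained via the antisymmetry `[i,j] = −[j,i]`). -/
def GenIdx (n : ℕ) := { p : ℕ × ℕ // 1 ≤ p.1 ∧ p.1 < p.2 ∧ p.2 ≤ n }

/-- The free `R`-algebra on the generators. -/
abbrev FreeE (n : ℕ) := FreeAlgebra (QRing n) (GenIdx n)

/-- The element `[i,j]` of the free algebra, for any `i ≠ j` in `{1,…,n}`, extended
antisymmetrically: `[i,j] = −[j,i]` (junk value `0` for out-of-range indices). -/
def eFree (n : ℕ) (i j : ℕ) : FreeE n :=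
  if h : 1 ≤ i ∧ i < j ∧ j ≤ n then FreeAlgebra.ι (QRing n) (⟨(i, j), h⟩ : GenIdx n)
  else if h' : 1 ≤ j ∧ j < i ∧ i ≤ n then - FreeAlgebra.ι (QRing n) (⟨(j, i), h'⟩ : GenIdx n)
  else 0

/-- The defining relations of the Fomin–Kirillov quantum quadratic algebra `𝓔_n^q`. -/
inductive ERel (n : ℕ) : FreeE n → FreeE n → Prop
  /-- `[i,j] = −[j,i]` -/
  | antisym : ∀ i j : ℕ, 1 ≤ i → 1 ≤ j → i ≤ n → j ≤ n → i ≠ j →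
      ERel n (eFree n i j) (- eFree n j i)
  /-- `[i,i+1]² = q_i` -/
  | sq_adj : ∀ i : ℕ, 1 ≤ i → i + 1 ≤ n →
      ERel n (eFree n i (i + 1) * eFree n i (i + 1))
        (algebraMap (QRing n) (FreeE n) (qElt n i))
  /-- `[i,j]² = 0` for `j > i+1` -/
  | sq : ∀ i j : ℕ, 1 ≤ i → i + 1 < j → j ≤ n →
      ERel n (eFree n i j * eFree n i j) 0
  /-- `[i,j][k,l] = [k,l][i,j]` for `{i,j} ∩ {k,l} = ∅` -/
  | comm : ∀ i j k l : ℕ, 1 ≤ i → 1 ≤ j → 1 ≤ k → 1 ≤ l →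
      i ≤ n → j ≤ n → k ≤ n → l ≤ n → i ≠ j → k ≠ l →
      i ≠ k → i ≠ l → j ≠ k → j ≠ l →
      ERel n (eFree n i j * eFree n k l) (eFree n k l * eFree n i j)
  /-- `[i,j][j,k] + [j,k][k,i] + [k,i][i,j] = 0` for distinct `i, j, k` -/
  | tri : ∀ i j k : ℕ, 1 ≤ i → 1 ≤ j → 1 ≤ k → i ≤ n → j ≤ n → k ≤ n →
      i ≠ j → j ≠ k → i ≠ k →
      ERel n (eFree n i j * eFree n j k + eFree n j k * eFree n k i
        + eFree n k i * eFree n i j) 0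

/-- The Fomin–Kirillov quantum quadratic algebra `𝓔_n^q` over `R`. -/
abbrev FKAlg (n : ℕ) := RingQuot (ERel n)

instance instFKRing (n : ℕ) : Ring (FKAlg n) := RingQuot.instRing (ERel n)

instance instFKAlgebra (n : ℕ) : Algebra (QRing n) (FKAlg n) := RingQuot.instAlgebra (ERel n)

/-- The element `[i,j]` of `𝓔_n^q`. -/
def eE (n : ℕ) (i j : ℕ) : FKAlg n :=
  RingQuot.mkAlgHom (QRing n) (ERel n) (eFree n i j)

/-- `h_{ij} = 1 + [i,j]`. -/
def hE (n : ℕ) (i j : ℕ) : FKAlg n := 1 + eE n i j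

/-- The inverse of `h_{ij}` (for `i < j`): `(1−q_i)⁻¹·(1 − [i,j])` if `j = i+1`,
and `1 − [i,j]` if `j > i+1`. -/
def hInvE (n : ℕ) (i j : ℕ) : FKAlg n :=
  if j = i + 1 then algebraMap (QRing n) (FKAlg n) (qInvElt n i) * ((1 : FKAlg n) - eE n i j)
  else (1 : FKAlg n) - eE n i j

/-- The ordered product `h_{m,k}·h_{m−1,k}·⋯·h_{1,k}` (equal to `1` for `m = 0`). -/
def leftProd (n k : ℕ) : ℕ → FKAlg n
  | 0 => 1
  | m + 1 => hE n (m + 1) k * leftProd n k m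

/-- The ordered product `h_{k,k+j}⁻¹·h_{k,k+j−1}⁻¹·⋯·h_{k,k+1}⁻¹` (equal to `1` for `j = 0`). -/
def rightProd (n k : ℕ) : ℕ → FKAlg n
  | 0 => 1
  | j + 1 => hInvE n k (k + j + 1) * rightProd n k j

/-- The multiplicative Dunkl element
`X_k = 1 − h_{k−1,k}·h_{k−2,k}·⋯·h_{1,k}·h_{k,n}⁻¹·h_{k,n−1}⁻¹·⋯·h_{k,k+1}⁻¹`. -/
def XDunkl (n k : ℕ) : FKAlg n :=
  (1 : FKAlg n) - leftProd n k (k - 1) * rightProd n k (n - k)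

/-- Moving `R k l` across a row of Yang–Baxter factors. -/
theorem mul_prod_mul_prod_of_yangBaxter {ι M : Type*} [Monoid M] (R : ι → ι → M) (k l : ι)
    (L : List ι) (hL : L.Nodup)
    (hyb : ∀ m ∈ L, R k l * R k m * R l m = R l m * R k m * R k l)
    (hcomm : ∀ m ∈ L, ∀ m' ∈ L, m ≠ m' → Commute (R k m) (R l m')) :
    R k l * ((L.map (R k)).prod * (L.map (R l)).prod)
      = (L.map (R l)).prod * (L.map (R k)).prod * R k l := by
  induction L with
  | nil => simp
  | cons m L ih =>
    obtain ⟨hm, hL⟩ := List.nodup_cons.mp hL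
    have ih := ih hL (fun a ha => hyb a (List.mem_cons_of_mem _ ha))
      (fun a ha b hb => hcomm a (List.mem_cons_of_mem _ ha) b (List.mem_cons_of_mem _ hb))
    have hk : Commute (L.map (R k)).prod (R l m) :=
      Commute.list_prod_left _ _ fun x hx => by
        obtain ⟨a, ha, rfl⟩ := List.mem_map.mp hx
        exact hcomm a (List.mem_cons_of_mem _ ha) m List.mem_cons_self
          (fun h => hm (h ▸ ha))
    have hl : Commute (R k m) (L.map (R l)).prod :=
      Commute.list_prod_right _ _ fun x hx => by
        obtain ⟨a, ha, rfl⟩ := List.mem_map.mp hx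
        exact hcomm m List.mem_cons_self a (List.mem_cons_of_mem _ ha)
          (fun h => hm (h ▸ ha))
    have hy := hyb m List.mem_cons_self
    simp only [List.map_cons, List.prod_cons]
    generalize (L.map (R k)).prod = P at *
    generalize (L.map (R l)).prod = Q at *
    calc R k l * (R k m * P * (R l m * Q))
        = R k l * R k m * (P * R l m) * Q := by simp only [mul_assoc]
      _ = R k l * R k m * R l m * (P * Q) := by rw [hk.eq]; simp only [mul_assoc]
      _ = R l m * R k m * (R k l * (P * Q)) := by rw [hy]; simp only [mul_assoc]
      _ = R l m * (R k m * Q) * P * R k l := by rw [ih]; simp only [mul_assoc]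
      _ = R l m * Q * (R k m * P) * R k l := by rw [hl.eq]; simp only [mul_assoc]

/-- Two transfer products built from a unitary solution of the Yang–Baxter equation commute. -/
theorem transfer_mul_transfer_of_yangBaxter {ι M : Type*} [Monoid M] (R : ι → ι → M) (k l : ι)
    (S T : List ι) (hST : (S ++ T).Nodup)
    (hkl : R k l * R l k = 1) (hlk : R l k * R k l = 1)
    (hyb : ∀ m ∈ S ++ T, R k l * R k m * R l m = R l m * R k m * R k l)
    (hyb' : ∀ m ∈ S ++ T, R l k * R l m * R k m = R k m * R l m * R l k)
    (hcomm : ∀ m ∈ S ++ T, ∀ m' ∈ S ++ T, m ≠ m' → Commute (R k m) (R l m')) :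
    ((S.map (R k)).prod * R k l * (T.map (R k)).prod)
        * ((T.map (R l)).prod * R l k * (S.map (R l)).prod)
      = ((T.map (R l)).prod * R l k * (S.map (R l)).prod)
        * ((S.map (R k)).prod * R k l * (T.map (R k)).prod) := by
  obtain ⟨hS, hT, hd⟩ := List.nodup_append'.mp hST
  have hmS : ∀ {a}, a ∈ S → a ∈ S ++ T := fun h => List.mem_append_left _ h
  have hmT : ∀ {a}, a ∈ T → a ∈ S ++ T := fun h => List.mem_append_right _ h
  have slideT := mul_prod_mul_prod_of_yangBaxter R k l T hT (fun m hm => hyb m (hmT hm))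
    (fun a ha b hb => hcomm a (hmT ha) b (hmT hb))
  have slideS := mul_prod_mul_prod_of_yangBaxter R l k S hS (fun m hm => hyb' m (hmS hm))
    (fun a ha b hb hab => (hcomm b (hmS hb) a (hmS ha) hab.symm).symm)
  have c₁ : Commute (S.map (R k)).prod (T.map (R l)).prod :=
    Commute.list_prod_left _ _ fun x hx => Commute.list_prod_right _ _ fun y hy => by
      obtain ⟨a, ha, rfl⟩ := List.mem_map.mp hx
      obtain ⟨b, hb, rfl⟩ := List.mem_map.mp hy
      exact hcomm a (hmS ha) b (hmT hb) (fun h => hd ha (h ▸ hb))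
  have c₂ : Commute (T.map (R k)).prod (S.map (R l)).prod :=
    Commute.list_prod_left _ _ fun x hx => Commute.list_prod_right _ _ fun y hy => by
      obtain ⟨a, ha, rfl⟩ := List.mem_map.mp hx
      obtain ⟨b, hb, rfl⟩ := List.mem_map.mp hy
      exact hcomm a (hmT ha) b (hmS hb) (fun h => hd hb (h ▸ ha))
  generalize (S.map (R k)).prod = Sk at *
  generalize (S.map (R l)).prod = Sl at *
  generalize (T.map (R k)).prod = Tk at *
  generalize (T.map (R l)).prod = Tl at *
  calc Sk * R k l * Tk * (Tl * R l k * Sl)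
      = Sk * (R k l * (Tk * Tl)) * R l k * Sl := by simp only [mul_assoc]
    _ = Sk * Tl * Tk * (R k l * R l k) * Sl := by rw [slideT]; simp only [mul_assoc]
    _ = (Sk * Tl) * (Tk * Sl) := by rw [hkl]; simp only [mul_assoc, one_mul]
    _ = Tl * (Sk * Sl) * (R l k * R k l) * Tk := by
        rw [c₁.eq, c₂.eq, hlk]; simp only [mul_assoc, one_mul]
    _ = Tl * (Sk * Sl * R l k) * R k l * Tk := by simp only [mul_assoc]
    _ = Tl * R l k * Sl * (Sk * R k l * Tk) := by rw [← slideS]; simp only [mul_assoc]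

/-- The Yang–Baxter equation from the two three-term relations. -/
theorem one_add_mul_yangBaxter {A : Type*} [Ring A] {a b c : A} (hab : a * b = b * c + c * a)
    (hba : b * a = a * c + c * b) (hbb : Commute (b * b) c) :
    (1 + a) * (1 + c) * (1 + b) = (1 + b) * (1 + c) * (1 + a) := by
  have hcubic : a * c * b = b * c * a := by
    have h₁ : a * c * b = b * a * b - c * (b * b) := by
      rw [hba]; noncomm_ring
    have h₂ : b * c * a = b * (a * b) - b * b * c := by
      rw [hab]; noncomm_ring
    rw [h₁, h₂, hbb.eq, mul_assoc]
  have h : (1 + a) * (1 + c) * (1 + b) - (1 + b) * (1 + c) * (1 + a)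
      = (a * b - (b * c + c * a)) - (b * a - (a * c + c * b)) + (a * c * b - b * c * a) := by
    noncomm_ring
  rw [← sub_eq_zero, h, hab, hba, hcubic]
  simp

/-- The index `i` lies in `{1, …, n}`. -/
abbrev InRange (n i : ℕ) : Prop := 1 ≤ i ∧ i ≤ n

section Relations

variable {n i j k l : ℕ}

theorem eE_antisymm (hi : InRange n i) (hj : InRange n j) (hij : i ≠ j) :
    eE n i j = -eE n j i := by
  simpa [eE] using
    RingQuot.mkAlgHom_rel (QRing n) (ERel.antisym i j hi.1 hj.1 hi.2 hj.2 hij)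

theorem eE_sq_adjacent (hi : 1 ≤ i) (hin : i + 1 ≤ n) :
    eE n i (i + 1) * eE n i (i + 1) = algebraMap (QRing n) (FKAlg n) (qElt n i) := by
  have h := RingQuot.mkAlgHom_rel (QRing n) (ERel.sq_adj i hi hin)
  rw [map_mul, AlgHom.commutes] at h
  exact h

theorem eE_sq (hi : 1 ≤ i) (hij : i + 1 < j) (hj : j ≤ n) : eE n i j * eE n i j = 0 := by
  simpa [eE] using RingQuot.mkAlgHom_rel (QRing n) (ERel.sq i j hi hij hj)

theorem eE_commute (hi : InRange n i) (hj : InRange n j) (hk : InRange n k) (hl : InRange n l)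
    (hij : i ≠ j) (hkl : k ≠ l) (hik : i ≠ k) (hil : i ≠ l) (hjk : j ≠ k) (hjl : j ≠ l) :
    Commute (eE n i j) (eE n k l) := by
  have h := RingQuot.mkAlgHom_rel (QRing n) (ERel.comm i j k l hi.1 hj.1 hk.1 hl.1
    hi.2 hj.2 hk.2 hl.2 hij hkl hik hil hjk hjl)
  rw [map_mul, map_mul] at h
  exact h

theorem eE_three_term (hi : InRange n i) (hj : InRange n j) (hk : InRange n k)
    (hij : i ≠ j) (hjk : j ≠ k) (hik : i ≠ k) :
    eE n i j * eE n j k + eE n j k * eE n k i + eE n k i * eE n i j = 0 := by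
  have h := RingQuot.mkAlgHom_rel (QRing n) (ERel.tri i j k hi.1 hj.1 hk.1
    hi.2 hj.2 hk.2 hij hjk hik)
  rw [map_add, map_add, map_mul, map_mul, map_mul, map_zero] at h
  exact h

theorem eE_sq_central (hi : InRange n i) (hj : InRange n j) (hij : i ≠ j) (x : FKAlg n) :
    Commute (eE n i j * eE n i j) x := by
  have key : ∀ {i j : ℕ}, 1 ≤ i → i < j → j ≤ n → Commute (eE n i j * eE n i j) x := by
    intro i j hi hij hj
    rcases Nat.eq_or_lt_of_le (Nat.succ_le_of_lt hij) with rfl | h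
    · rw [eE_sq_adjacent hi hj]
      exact Algebra.commutes _ _
    · rw [eE_sq hi h hj]
      exact Commute.zero_left _
  rcases Nat.lt_or_gt_of_ne hij with h | h
  · exact key hi.1 h hj.2
  · rw [eE_antisymm hi hj hij, neg_mul_neg]
    exact key hj.1 h hi.2

theorem one_add_eE_yangBaxter (hi : InRange n i) (hj : InRange n j) (hk : InRange n k)
    (hij : i ≠ j) (hjk : j ≠ k) (hik : i ≠ k) :
    (1 + eE n j i) * (1 + eE n k i) * (1 + eE n k j)
      = (1 + eE n k j) * (1 + eE n k i) * (1 + eE n j i) := by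
  refine one_add_mul_yangBaxter ?_ ?_ (eE_sq_central hk hj hjk.symm _)
  · have h := eE_three_term hi hj hk hij hjk hik
    rw [eE_antisymm hi hj hij, eE_antisymm hj hk hjk] at h
    rw [← sub_eq_zero, ← h]
    noncomm_ring
  · have h := eE_three_term hk hj hi hjk.symm hij.symm hik.symm
    rw [eE_antisymm hi hk hik] at h
    rw [← sub_eq_zero, ← h]
    noncomm_ring

theorem one_sub_qElt_mul_qInvElt (hi : 1 ≤ i) (hin : i + 1 ≤ n) :
    (1 - qElt n i) * qInvElt n i = 1 := by
  have h : i - 1 < n - 1 := by omega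
  simp only [qElt, qInvElt, dif_pos h]
  rw [← map_one (algebraMap (QPoly n) (QRing n)), ← map_sub, ← Localization.mk_one_eq_algebraMap,
    Localization.mk_mul, mul_one, one_mul, map_one]
  exact Localization.mk_self
    (⟨1 - MvPolynomial.X ⟨i - 1, h⟩, Submonoid.subset_closure ⟨⟨i - 1, h⟩, rfl⟩⟩ : qSubmonoid n)

end Relations

/-- The normalizing scalar of the factor `1 + [m,k]` of the Dunkl element `X_k`. -/
def dunklScalar (n k m : ℕ) : QRing n := if m = k + 1 then qInvElt n k else 1

/-- The factor of `X_k` pairing `k` with `m`: `h_{mk}` for `m < k` and `h_{km}⁻¹` for `k < m`. -/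
def dunklFactor (n k m : ℕ) : FKAlg n :=
  algebraMap (QRing n) (FKAlg n) (dunklScalar n k m) * (1 + eE n m k)

section Factors

variable {n i j k l m : ℕ}

theorem dunklFactor_of_lt (h : m < k) : dunklFactor n k m = hE n m k := by
  rw [dunklFactor, dunklScalar, if_neg (by omega), map_one, one_mul, hE]

theorem dunklFactor_of_gt (hk : 1 ≤ k) (h : k < m) (hm : m ≤ n) :
    dunklFactor n k m = hInvE n k m := by
  rw [dunklFactor, dunklScalar, hInvE, eE_antisymm (i := m) ⟨by omega, hm⟩ ⟨hk, by omega⟩ h.ne',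
    ← sub_eq_add_neg]
  split_ifs
  · rfl
  · rw [map_one, one_mul]

theorem hE_mul_hInvE (hi : 1 ≤ i) (hij : i < j) (hj : j ≤ n) : hE n i j * hInvE n i j = 1 := by
  have hsq : (1 + eE n i j) * (1 - eE n i j) = 1 - eE n i j * eE n i j := by noncomm_ring
  rw [hE, hInvE]
  split_ifs with h
  · subst h
    rw [← mul_assoc, ← Algebra.commutes, mul_assoc, hsq, eE_sq_adjacent hi hj,
      ← map_one (algebraMap (QRing n) (FKAlg n)), ← map_sub, ← map_mul, mul_comm,
      one_sub_qElt_mul_qInvElt hi hj]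
  · rw [hsq, eE_sq hi (by omega) hj, sub_zero]

theorem hInvE_mul_hE (hi : 1 ≤ i) (hij : i < j) (hj : j ≤ n) : hInvE n i j * hE n i j = 1 := by
  have hcomm : Commute (hE n i j) (hInvE n i j) := by
    have h₀ : Commute (1 + eE n i j) (1 - eE n i j) :=
      ((Commute.one_left _).add_left ((Commute.one_right _).sub_right (Commute.refl _)))
    rw [hE, hInvE]
    split_ifs
    · exact (Algebra.commute_algebraMap_right _ _).mul_right h₀
    · exact h₀
  rw [← hcomm.eq, hE_mul_hInvE hi hij hj]

theorem dunklFactor_unitary (hk : InRange n k) (hl : InRange n l) (hkl : k ≠ l) :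
    dunklFactor n k l * dunklFactor n l k = 1 := by
  rcases Nat.lt_or_gt_of_ne hkl with h | h
  · rw [dunklFactor_of_gt hk.1 h hl.2, dunklFactor_of_lt h, hInvE_mul_hE hk.1 h hl.2]
  · rw [dunklFactor_of_gt hl.1 h hk.2, dunklFactor_of_lt h, hE_mul_hInvE hl.1 h hk.2]

theorem dunklFactor_yangBaxter (hi : InRange n i) (hj : InRange n j) (hk : InRange n k)
    (hij : i ≠ j) (hjk : j ≠ k) (hik : i ≠ k) :
    dunklFactor n i j * dunklFactor n i k * dunklFactor n j k
      = dunklFactor n j k * dunklFactor n i k * dunklFactor n i j := by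
  have collect : ∀ (x y z : QRing n) (a b c : FKAlg n),
      algebraMap (QRing n) (FKAlg n) x * a * (algebraMap (QRing n) (FKAlg n) y * b)
          * (algebraMap (QRing n) (FKAlg n) z * c)
        = algebraMap (QRing n) (FKAlg n) (x * y * z) * (a * b * c) := by
    intro x y z a b c
    rw [(Algebra.commute_algebraMap_left y a).symm.mul_mul_mul_comm,
      (Algebra.commute_algebraMap_left z (a * b)).symm.mul_mul_mul_comm, map_mul, map_mul]
  simp only [dunklFactor]
  rw [collect, collect, one_add_eE_yangBaxter hi hj hk hij hjk hik, mul_right_comm,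
    mul_comm (dunklScalar n i j), mul_right_comm, mul_right_comm (dunklScalar n j k)]

theorem dunklFactor_commute (hi : InRange n i) (hj : InRange n j) (hk : InRange n k)
    (hl : InRange n l) (hij : i ≠ j) (hkl : k ≠ l) (hik : i ≠ k) (hil : i ≠ l) (hjk : j ≠ k)
    (hjl : j ≠ l) : Commute (dunklFactor n i j) (dunklFactor n k l) := by
  have h := eE_commute hj hi hl hk hij.symm hkl.symm hjl hjk hil hik
  exact (Algebra.commute_algebraMap_left _ _).mul_left
    ((Algebra.commute_algebraMap_right _ _).mul_right
      ((Commute.one_left _).add_left ((Commute.one_right _).add_right h)))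

theorem leftProd_add (a : ℕ) :
    ∀ b, a + b < k → leftProd n k (a + b)
      = ((List.range' (a + 1) b).reverse.map (dunklFactor n k)).prod * leftProd n k a
  | 0, _ => by simp
  | b + 1, h => by
    rw [← add_assoc, leftProd, leftProd_add a b (by omega), List.range'_1_concat,
      List.reverse_append, List.reverse_singleton, List.singleton_append, List.map_cons,
      List.prod_cons, dunklFactor_of_lt (by omega), mul_assoc, add_right_comm]

theorem rightProd_add (hk : 1 ≤ k) (a : ℕ) :
    ∀ b, k + (a + b) ≤ n → rightProd n k (a + b)
      = ((List.range' (k + a + 1) b).reverse.map (dunklFactor n k)).prod * rightProd n k a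
  | 0, _ => by simp
  | b + 1, h => by
    rw [← add_assoc, rightProd, rightProd_add hk a b (by omega), List.range'_1_concat,
      List.reverse_append, List.reverse_singleton, List.singleton_append, List.map_cons,
      List.prod_cons, dunklFactor_of_gt hk (by omega) (by omega), mul_assoc,
      show k + (a + b) + 1 = k + a + 1 + b by omega]

theorem leftProd_eq (h : m < k) :
    leftProd n k m = ((List.range' 1 m).reverse.map (dunklFactor n k)).prod := by
  simpa [leftProd] using leftProd_add (n := n) (k := k) 0 m (by omega)

theorem rightProd_eq (hk : 1 ≤ k) (h : k + m ≤ n) :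
    rightProd n k m = ((List.range' (k + 1) m).reverse.map (dunklFactor n k)).prod := by
  simpa [rightProd] using rightProd_add (n := n) hk 0 m (by omega)

theorem dunklProduct_commute_of_lt (hk : 1 ≤ k) (hkl : k < l) (hl : l ≤ n) :
    Commute (leftProd n k (k - 1) * rightProd n k (n - k))
      (leftProd n l (l - 1) * rightProd n l (n - l)) := by
  set S := (List.range' 1 (k - 1)).reverse ++ (List.range' (l + 1) (n - l)).reverse with hS
  set T := (List.range' (k + 1) (l - k - 1)).reverse with hT
  have hk' : leftProd n k (k - 1) * rightProd n k (n - k)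
      = (S.map (dunklFactor n k)).prod * dunklFactor n k l * (T.map (dunklFactor n k)).prod := by
    rw [show n - k = (l - k - 1 + 1) + (n - l) by omega,
      rightProd_add hk _ _ (by omega), rightProd, ← dunklFactor_of_gt hk (by omega) (by omega),
      rightProd_eq hk (by omega), leftProd_eq (by omega), hS, List.map_append, List.prod_append,
      show k + (l - k - 1) + 1 = l by omega, show k + (l - k - 1 + 1) + 1 = l + 1 by omega]
    simp only [mul_assoc]
    rfl
  have hl' : leftProd n l (l - 1) * rightProd n l (n - l)
      = (T.map (dunklFactor n l)).prod * dunklFactor n l k * (S.map (dunklFactor n l)).prod := by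
    rw [show l - 1 = (k - 1 + 1) + (l - k - 1) by omega, leftProd_add _ _ (by omega), leftProd,
      ← dunklFactor_of_lt (by omega), rightProd_eq (by omega) (by omega), leftProd_eq (by omega),
      hS, List.map_append, List.prod_append, show k - 1 + 1 = k by omega]
    simp only [mul_assoc]
    rfl
  have hmem : ∀ m ∈ S ++ T, InRange n m ∧ m ≠ k ∧ m ≠ l := by
    intro m hm
    simp only [hS, hT, List.mem_append, List.mem_reverse, List.mem_range'_1] at hm
    omega
  have hnodup : (S ++ T).Nodup := by
    have hrange : ∀ a b : ℕ, (List.range' a b).reverse.Nodup := fun a b =>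
      List.nodup_reverse.mpr List.nodup_range'
    refine (((hrange _ _).append (hrange _ _) ?_).append (hrange _ _) ?_) <;> intro m h₁ h₂ <;>
      simp only [hT, List.mem_append, List.mem_reverse, List.mem_range'_1] at h₁ h₂ <;> omega
  have rk : InRange n k := ⟨hk, by omega⟩
  have rl : InRange n l := ⟨by omega, hl⟩
  rw [hk', hl']
  refine transfer_mul_transfer_of_yangBaxter (dunklFactor n) k l S T hnodup
    (dunklFactor_unitary rk rl hkl.ne) (dunklFactor_unitary rl rk hkl.ne')
    (fun m hm => ?_) (fun m hm => ?_) (fun a ha b hb hab => ?_)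
  · obtain ⟨hm, h₁, h₂⟩ := hmem m hm
    exact dunklFactor_yangBaxter rk rl hm hkl.ne h₂.symm h₁.symm
  · obtain ⟨hm, h₁, h₂⟩ := hmem m hm
    exact dunklFactor_yangBaxter rl rk hm hkl.ne' h₁.symm h₂.symm
  · obtain ⟨ra, h₁, h₂⟩ := hmem a ha
    obtain ⟨rb, h₃, h₄⟩ := hmem b hb
    exact dunklFactor_commute rk ra rl rb h₁.symm h₄.symm hkl.ne h₃.symm h₂ hab

theorem XDunkl_commute_of_lt (hk : 1 ≤ k) (hkl : k < l) (hl : l ≤ n) :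
    Commute (XDunkl n k) (XDunkl n l) :=
  (Commute.one_left _).sub_left
    ((Commute.one_right _).sub_right (dunklProduct_commute_of_lt hk hkl hl))

end Factors

/-- In the Fomin–Kirillov quantum quadratic algebra `𝓔_n^q` over `R`, the multiplicative
Dunkl elements `X_1, …, X_n` pairwise commute. -/
theorem statement15 (n : ℕ) (hn : 2 ≤ n) (k l : ℕ)
    (hk1 : 1 ≤ k) (hkn : k ≤ n) (hl1 : 1 ≤ l) (hln : l ≤ n) :
    XDunkl n k * XDunkl n l = XDunkl n l * XDunkl n k := by
  rcases lt_trichotomy k l with h | rfl | h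
  · exact XDunkl_commute_of_lt hk1 h hln
  · rfl
  · exact (XDunkl_commute_of_lt hl1 h hkn).symm.eq
end
end
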